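/- For all integers n ≥ 0 and k ≥ 1, the number of lattice paths of length 2n+1 that stay in the strip [-k, k] and end at height -1 is equal to the number of lattice paths of length 2n+1 that stay in the strip [0, 2k] (with no restriction on the final height). -/

import Mathlib

/-- The height of a lattice path `s : Fin n → ℤ` after `j` steps:
the sum of the first `j` steps. -/
def pathHeight {n : ℕ} (s : Fin n → ℤ) (j : ℕ) : ℤ :=
  ∑ i ∈ Finset.univ.filter (fun i : Fin n => (i : ℕ) < j), s i

/-- The number of lattice paths of length `n` (steps `±1`) whose height stays in
`[a, b]` at every time `0 ≤ j ≤ n` and whose final height lies in `E`. -/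
noncomputable def pathCount (n : ℕ) (a b : ℤ) (E : Set ℤ) : ℕ :=
  Nat.card {s : Fin n → ℤ //
    (∀ i, s i ∈ ({1, -1} : Set ℤ)) ∧
    (∀ j ≤ n, pathHeight s j ∈ Set.Icc a b) ∧
    pathHeight s n ∈ E}

/-- The number of `±1` walks of length `N` from `a` to `b` staying in `[0, M]`,
defined by recursion on the first step. -/
def stripWalks (M : ℤ) : ℕ → ℤ → ℤ → ℕ
  | 0, a, b => if a = b ∧ 0 ≤ a ∧ a ≤ M then 1 else 0
  | N + 1, a, b =>
    if 0 ≤ a ∧ a ≤ M then stripWalks M N (a + 1) b + stripWalks M N (a - 1) b else 0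

theorem stripWalks_succ_last (M : ℤ) (N : ℕ) (a b : ℤ) :
    stripWalks M (N + 1) a b =
      if 0 ≤ b ∧ b ≤ M then stripWalks M N a (b + 1) + stripWalks M N a (b - 1) else 0 := by
  induction N generalizing a b with
  | zero =>
    simp only [stripWalks]
    split_ifs <;> omega
  | succ N ih =>
    rw [stripWalks, ih, ih]
    simp only [stripWalks]
    split_ifs <;> omega

theorem stripWalks_comm (M : ℤ) (N : ℕ) (a b : ℤ) :
    stripWalks M N a b = stripWalks M N b a := by
  induction N generalizing a b with
  | zero =>
    simp only [stripWalks]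
    split_ifs <;> omega
  | succ N ih =>
    rw [stripWalks_succ_last, stripWalks, ih a, ih a]

theorem stripWalks_eq_zero_of_left_neg (M : ℤ) (N : ℕ) {a : ℤ} (b : ℤ) (ha : a < 0) :
    stripWalks M N a b = 0 := by
  cases N <;> simp only [stripWalks] <;> rw [if_neg (by omega)]

theorem stripWalks_eq_zero_of_odd (M : ℤ) (N : ℕ) (a b : ℤ) (h : (N + a + b) % 2 = 1) :
    stripWalks M N a b = 0 := by
  induction N generalizing a with
  | zero =>
    rw [stripWalks, if_neg]
    push_cast at h
    omega
  | succ N ih =>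
    push_cast at h
    rw [stripWalks, ih (a + 1) (by omega), ih (a - 1) (by omega)]
    simp

/-- The discrete wave equation in the two endpoints of a walk. -/
theorem stripWalks_wave (M : ℤ) (N : ℕ) {a b : ℤ} (ha : 0 ≤ a ∧ a ≤ M) (hb : 0 ≤ b ∧ b ≤ M) :
    stripWalks M N (a + 1) b + stripWalks M N (a - 1) b =
      stripWalks M N a (b + 1) + stripWalks M N a (b - 1) := by
  have h := stripWalks_succ_last M N a b
  rwa [stripWalks, if_pos ha, if_pos hb] at h

theorem stripWalks_eq_sum (M : ℤ) (N a : ℕ) (b : ℤ) (hab : a ≤ b) (hM : a + b ≤ M) :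
    stripWalks M N a b = ∑ i ∈ Finset.range (a + 1), stripWalks M N 0 (b - a + 2 * i) := by
  induction a using Nat.strong_induction_on generalizing b with
  | _ a ih =>
    match a with
    | 0 => simp
    | 1 =>
      have h := stripWalks_wave M N (a := 0) (b := b) (by omega) (by omega)
      rw [stripWalks_eq_zero_of_left_neg M N (a := 0 - 1) b (by omega)] at h
      simp only [Finset.sum_range_succ, Finset.sum_range_zero]
      norm_num at h ⊢
      rw [h, show b - 1 + 2 = b + 1 by ring, add_comm]
    | a + 2 =>
      push_cast at hab hM
      have h := stripWalks_wave M N (a := (a + 1 : ℕ)) (b := b) (by omega) (by omega)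
      rw [ih (a + 1) (by omega) (b + 1) (by omega) (by omega),
        ih (a + 1) (by omega) (b - 1) (by omega) (by omega),
        show ((a + 1 : ℕ) : ℤ) - 1 = (a : ℕ) by push_cast; ring,
        ih a (by omega) b (by omega) (by omega),
        Finset.sum_range_succ _ (a + 1)] at h
      rw [Finset.sum_range_succ _ (a + 2)]
      have e1 : ∀ i : ℕ, b + 1 - ((a + 1 : ℕ) : ℤ) + 2 * i = b - a + 2 * i := by
        intro i; push_cast; ring
      have e2 : ∀ i : ℕ, b - 1 - ((a + 1 : ℕ) : ℤ) + 2 * i = b - (a + 2 : ℕ) + 2 * i := by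
        intro i; push_cast; ring
      have e3 : b - ((a + 2 : ℕ) : ℤ) + 2 * ((a + 2 : ℕ) : ℤ) = b - a + 2 * ((a + 1 : ℕ) : ℤ) := by
        push_cast; ring
      have e4 : ((a + 1 : ℕ) : ℤ) + 1 = (a + 2 : ℕ) := by push_cast; ring
      simp only [e1, e2, e4, show a + 1 + 1 = a + 2 from rfl] at h
      rw [e3]
      omega

theorem sum_stripWalks_zero_odd (n k : ℕ) :
    ∑ c ∈ Finset.Icc (0 : ℤ) (2 * k), stripWalks (2 * k) (2 * n + 1) 0 c =
      ∑ i ∈ Finset.range k, stripWalks (2 * k) (2 * n + 1) 0 (1 + 2 * i) := by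
  symm
  refine Finset.sum_of_injOn (fun i : ℕ => (1 + 2 * i : ℤ)) ?_ ?_ ?_ (fun _ _ => rfl)
  · intro x _ y _ h
    simp only at h
    omega
  · intro i hi
    simp only [Finset.coe_range, Set.mem_Iio, Finset.coe_Icc, Set.mem_Icc] at hi ⊢
    omega
  · intro c hc hc'
    apply stripWalks_eq_zero_of_odd
    simp only [Finset.coe_range, Set.mem_image, Set.mem_Iio, Finset.mem_Icc, not_exists,
      not_and] at hc hc'
    have := hc' ((c / 2).toNat)
    push_cast
    omega

theorem pathHeight_zero {n : ℕ} (s : Fin n → ℤ) : pathHeight s 0 = 0 := by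
  simp [pathHeight]

theorem pathHeight_cons_succ {n : ℕ} (d : ℤ) (s : Fin n → ℤ) (j : ℕ) :
    pathHeight (Fin.cons d s : Fin (n + 1) → ℤ) (j + 1) = d + pathHeight s j := by
  simp [pathHeight, Finset.sum_filter, Fin.sum_univ_succ]

/-- The set of lattice paths counted by `pathCount`. -/
def pathSet (n : ℕ) (a b : ℤ) (E : Set ℤ) : Set (Fin n → ℤ) :=
  {s | (∀ i, s i ∈ ({1, -1} : Set ℤ)) ∧
    (∀ j ≤ n, pathHeight s j ∈ Set.Icc a b) ∧ pathHeight s n ∈ E}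

theorem pathCount_eq_ncard (n : ℕ) (a b : ℤ) (E : Set ℤ) :
    pathCount n a b E = (pathSet n a b E).ncard := rfl

theorem pathSet_finite (n : ℕ) (a b : ℤ) (E : Set ℤ) : (pathSet n a b E).Finite :=
  (Set.Finite.pi' (fun _ : Fin n => Set.toFinite ({1, -1} : Set ℤ))).subset fun _ h => h.1

theorem cons_mem_pathSet {n : ℕ} {a b : ℤ} {E : Set ℤ} {d : ℤ} {s : Fin n → ℤ} :
    (Fin.cons d s : Fin (n + 1) → ℤ) ∈ pathSet (n + 1) a b E ↔
      (d = 1 ∨ d = -1) ∧ (a ≤ 0 ∧ 0 ≤ b) ∧ s ∈ pathSet n (a - d) (b - d) ((d + ·) ⁻¹' E) := by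
  have hj : (∀ j ≤ n + 1, pathHeight (Fin.cons d s : Fin (n + 1) → ℤ) j ∈ Set.Icc a b) ↔
      (a ≤ 0 ∧ 0 ≤ b) ∧ ∀ j ≤ n, pathHeight s j ∈ Set.Icc (a - d) (b - d) := by
    constructor
    · intro h
      refine ⟨by simpa [pathHeight_zero] using h 0 (by omega), fun j hj => ?_⟩
      have := h (j + 1) (by omega)
      rw [pathHeight_cons_succ, Set.mem_Icc] at this
      rw [Set.mem_Icc]
      omega
    · rintro ⟨h0, h⟩ (_ | j) hj
      · simpa [pathHeight_zero] using h0
      · have := h j (by omega)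
        rw [Set.mem_Icc] at this
        rw [pathHeight_cons_succ, Set.mem_Icc]
        omega
  simp only [pathSet, Set.mem_ofPred_eq, hj, pathHeight_cons_succ, Fin.forall_fin_succ,
    Fin.cons_zero, Fin.cons_succ, Set.mem_insert_iff, Set.mem_singleton_iff, Set.mem_preimage]
  tauto

theorem pathCount_succ (n : ℕ) (a b : ℤ) (E : Set ℤ) (h : a ≤ 0 ∧ 0 ≤ b) :
    pathCount (n + 1) a b E =
      pathCount n (a - 1) (b - 1) ((1 + ·) ⁻¹' E) +
        pathCount n (a + 1) (b + 1) ((-1 + ·) ⁻¹' E) := by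
  have hunion : pathSet (n + 1) a b E =
      (fun t : Fin n → ℤ => (Fin.cons (1 : ℤ) t : Fin (n + 1) → ℤ)) ''
          pathSet n (a - 1) (b - 1) ((1 + ·) ⁻¹' E) ∪
        (fun t : Fin n → ℤ => (Fin.cons (-1 : ℤ) t : Fin (n + 1) → ℤ)) ''
          pathSet n (a + 1) (b + 1) ((-1 + ·) ⁻¹' E) := by
    ext s
    constructor
    · intro hs
      rw [← Fin.cons_self_tail s, cons_mem_pathSet] at hs
      obtain ⟨hd, -, ht⟩ := hs
      rcases hd with hd | hd <;> rw [hd] at ht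
      · exact Or.inl ⟨Fin.tail s, ht, by simp only [← hd, Fin.cons_self_tail]⟩
      · exact Or.inr ⟨Fin.tail s, by simpa using ht, by simp only [← hd, Fin.cons_self_tail]⟩
    · rintro (⟨t, ht, rfl⟩ | ⟨t, ht, rfl⟩)
      · exact cons_mem_pathSet.2 ⟨Or.inl rfl, h, ht⟩
      · exact cons_mem_pathSet.2 ⟨Or.inr rfl, h, by simpa using ht⟩
  have hinj : ∀ d : ℤ, Function.Injective
      (fun t : Fin n → ℤ => (Fin.cons d t : Fin (n + 1) → ℤ)) :=
    fun _ _ _ h => (Fin.cons_inj.1 h).2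
  simp only [pathCount_eq_ncard]
  rw [hunion, Set.ncard_union_eq ?_ ((pathSet_finite ..).image _) ((pathSet_finite ..).image _),
    Set.ncard_image_of_injective _ (hinj 1),
    Set.ncard_image_of_injective _ (hinj (-1))]
  rw [Set.disjoint_left]
  rintro _ ⟨t, -, rfl⟩ ⟨u, -, hu⟩
  have := congrFun hu 0
  simp at this

theorem pathCount_eq_zero (n : ℕ) (a b : ℤ) (E : Set ℤ) (h : ¬(a ≤ 0 ∧ 0 ≤ b)) :
    pathCount n a b E = 0 := by
  rw [pathCount_eq_ncard, Set.ncard_eq_zero (pathSet_finite ..), Set.eq_empty_iff_forall_notMem]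
  rintro s ⟨-, hs, -⟩
  exact h (by simpa [pathHeight_zero] using hs 0 (by omega))

theorem pathCount_zero_of_mem (a b : ℤ) (E : Set ℤ) (h : a ≤ 0 ∧ 0 ≤ b) (hE : 0 ∈ E) :
    pathCount 0 a b E = 1 := by
  rw [pathCount_eq_ncard, Set.ncard_eq_one]
  refine ⟨Fin.elim0, Set.eq_singleton_iff_unique_mem.2
    ⟨⟨fun i => i.elim0, ?_, ?_⟩, fun _ _ => Subsingleton.elim _ _⟩⟩
  · intro j hj
    rw [Nat.le_zero.1 hj, pathHeight_zero]
    exact h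
  · rwa [pathHeight_zero]

theorem pathCount_zero_of_notMem (a b : ℤ) (E : Set ℤ) (hE : 0 ∉ E) :
    pathCount 0 a b E = 0 := by
  rw [pathCount_eq_ncard, Set.ncard_eq_zero (pathSet_finite ..), Set.eq_empty_iff_forall_notMem]
  rintro s ⟨-, -, hs⟩
  rw [pathHeight_zero] at hs
  exact hE hs

theorem pathCount_eq_sum_stripWalks (M : ℤ) (N : ℕ) (x : ℤ) (S : Finset ℤ) :
    pathCount N (-x) (M - x) {h | x + h ∈ S} = ∑ c ∈ S, stripWalks M N x c := by
  induction N generalizing x with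
  | zero =>
    by_cases hx : 0 ≤ x ∧ x ≤ M
    · simp only [stripWalks, hx, and_self, and_true, Finset.sum_ite_eq]
      split_ifs with hS
      · exact pathCount_zero_of_mem _ _ _ (by omega) (by simpa using hS)
      · exact pathCount_zero_of_notMem _ _ _ (by simpa using hS)
    · rw [pathCount_eq_zero _ _ _ _ (by omega)]
      simp [stripWalks, hx]
  | succ N ih =>
    by_cases hx : 0 ≤ x ∧ x ≤ M
    · rw [pathCount_succ _ _ _ _ (by omega)]
      simp only [stripWalks, if_pos hx, Finset.sum_add_distrib, ← ih, Set.preimage_ofPred_eq]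
      congr 2
      · ring
      · ring
      · simp only [add_assoc]
      · ring
      · ring
      · simp only [sub_eq_add_neg, add_assoc]
    · rw [pathCount_eq_zero _ _ _ _ (by omega)]
      simp [stripWalks, hx]

theorem stmt_3 (n k : ℕ) (hk : 1 ≤ k) :
    pathCount (2 * n + 1) (-(k : ℤ)) (k : ℤ) ({-1} : Set ℤ)
      = pathCount (2 * n + 1) 0 (2 * k : ℤ) Set.univ := by
  have hleft := pathCount_eq_sum_stripWalks (2 * k) (2 * n + 1) k {(k : ℤ) - 1}
  have hright := pathCount_eq_sum_stripWalks (2 * k) (2 * n + 1) 0 (Finset.Icc 0 (2 * k))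
  have hset : {h : ℤ | (k : ℤ) + h ∈ ({(k : ℤ) - 1} : Finset ℤ)} = {-1} := by
    ext h
    simp only [Finset.mem_singleton, Set.mem_ofPred_eq, Set.mem_singleton_iff]
    omega
  have huniv : pathCount (2 * n + 1) 0 (2 * k : ℤ) Set.univ =
      pathCount (2 * n + 1) (-0) (2 * k - 0 : ℤ)
        {h | 0 + h ∈ Finset.Icc (0 : ℤ) (2 * k)} := by
    simp only [neg_zero, sub_zero, pathCount_eq_ncard]
    congr 1
    ext s
    simp only [pathSet, Set.mem_ofPred_eq, Set.mem_univ, and_true, zero_add, Finset.mem_Icc]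
    exact ⟨fun h => ⟨h.1, h.2, h.2 _ le_rfl⟩, fun h => ⟨h.1, h.2.1⟩⟩
  rw [hset, show (2 * k - k : ℤ) = k by ring, Finset.sum_singleton, stripWalks_comm] at hleft
  rw [huniv, hright, hleft, sum_stripWalks_zero_odd]
  obtain ⟨m, rfl⟩ : ∃ m, k = m + 1 := ⟨k - 1, by omega⟩
  have h := stripWalks_eq_sum (2 * (m + 1 : ℕ)) (2 * n + 1) m (m + 1 : ℕ) (by omega) (by omega)
  rw [show ((m + 1 : ℕ) : ℤ) - 1 = m by push_cast; ring, h]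
  simp
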